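/- Let q be an odd prime power. The point sets E₀ and E_{q−1} of PG(3,q²) have equal cardinality, namely |E₀| = |E_{q−1}| = q³(q²+1)/2 + q² + 1. -/

import Mathlib

noncomputable section

open Matrix

/-- The points of `PG(3,q²)`: the projectivization of `F⁴` where `F = 𝔽_{q²}`. -/
abbrev PGPoint (F : Type*) [Field F] := Projectivization F (Fin 4 → F)

/-- The form `F_γ(X₁,X₂,X₃,X₄) = X₁^q X₄ + X₁ X₄^q − X₂^{q+1} − X₃^{q+1}
    − γ (X₁X₄ − X₂X₃)^{(q+1)/2}`. -/
def Fgam {F : Type*} [Field F] (q : ℕ) (γ : F) (x : Fin 4 → F) : F :=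
  x 0 ^ q * x 3 + x 0 * x 3 ^ q - x 1 ^ (q + 1) - x 2 ^ (q + 1)
    - γ * (x 0 * x 3 - x 1 * x 2) ^ ((q + 1) / 2)

/-- The point set `C_γ` of `PG(3,q²)`, the zero locus of `F_γ`. -/
def Cgam {F : Type*} [Field F] (q : ℕ) (γ : F) : Set (PGPoint F) :=
  {P | ∀ (v : Fin 4 → F) (hv : v ≠ 0), P = Projectivization.mk F v hv → Fgam q γ v = 0}

/-- Kronecker product of two 2×2 matrices, as a 4×4 matrix. -/
def kron {F : Type*} [Field F] (A B : Matrix (Fin 2) (Fin 2) F) :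
    Matrix (Fin 4) (Fin 4) F :=
  Matrix.of fun i j =>
    A ⟨i.val / 2, by have := i.isLt; omega⟩ ⟨j.val / 2, by have := j.isLt; omega⟩ *
    B ⟨i.val % 2, by have := i.isLt; omega⟩ ⟨j.val % 2, by have := j.isLt; omega⟩

/-- Entrywise `q`-th power (the matrix `A^q`). -/
def matq {F : Type*} [Field F] (q : ℕ) (A : Matrix (Fin 2) (Fin 2) F) :
    Matrix (Fin 2) (Fin 2) F :=
  A.map (· ^ q)

/-- The orbit of a point of `PG(3,q²)` under the group `K ≅ PSL(2,q²)` of projectivities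
    induced by the matrices `A^q ⊗ A` with `A ∈ SL(2,𝔽_{q²})`. -/
def Korb {F : Type*} [Field F] (q : ℕ) (P : PGPoint F) : Set (PGPoint F) :=
  {P' | ∃ A : Matrix (Fin 2) (Fin 2) F, A.det = 1 ∧
    ∃ (v : Fin 4 → F) (hv : v ≠ 0) (hw : Matrix.vecMul v (kron (matq q A) A) ≠ 0),
      P = Projectivization.mk F v hv ∧ P' = Projectivization.mk F _ hw}

/-- The orbit of a point of `PG(3,q²)` under the group `G ≅ PGL(2,q²)` of projectivities
    induced by the matrices `A^q ⊗ A` with `A ∈ GL(2,𝔽_{q²})`. -/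
def Gorb {F : Type*} [Field F] (q : ℕ) (P : PGPoint F) : Set (PGPoint F) :=
  {P' | ∃ A : Matrix (Fin 2) (Fin 2) F, A.det ≠ 0 ∧
    ∃ (v : Fin 4 → F) (hv : v ≠ 0) (hw : Matrix.vecMul v (kron (matq q A) A) ≠ 0),
      P = Projectivization.mk F v hv ∧ P' = Projectivization.mk F _ hw}

/-- The Hermitian Veronese curve `O = {(1,t,t^q,t^{q+1})} ∪ {(0,0,0,1)}`. -/
def Oset (F : Type*) [Field F] (q : ℕ) : Set (PGPoint F) :=
  {P | (∃ (t : F) (hv : ![1, t, t ^ q, t ^ (q + 1)] ≠ 0),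
        P = Projectivization.mk F _ hv) ∨
    ∃ (hv : (![0, 0, 0, 1] : Fin 4 → F) ≠ 0), P = Projectivization.mk F _ hv}

/-- The Baer subgeometry `Σ = {(a,b,b^q,c) : a,c ∈ 𝔽_q, b ∈ 𝔽_{q²}}`. -/
def SigmaSet (F : Type*) [Field F] (q : ℕ) : Set (PGPoint F) :=
  {P | ∃ (a b c : F) (hv : ![a, b, b ^ q, c] ≠ 0),
    a ^ q = a ∧ c ^ q = c ∧ P = Projectivization.mk F _ hv}

/-- The hyperbolic quadric `Q⁺(3,q²) : X₁X₄ − X₂X₃ = 0`. -/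
def Qplus (F : Type*) [Field F] : Set (PGPoint F) :=
  {P | ∀ (v : Fin 4 → F) (hv : v ≠ 0), P = Projectivization.mk F v hv →
    v 0 * v 3 - v 1 * v 2 = 0}

/-- A line of `PG(3,q²)`: the set of points lying in a 2-dimensional subspace. -/
def IsLine {F : Type*} [Field F] (ℓ : Set (PGPoint F)) : Prop :=
  ∃ W : Submodule F (Fin 4 → F), Module.finrank F W = 2 ∧ ℓ = {P | P.rep ∈ W}

/-- A plane of `PG(3,q²)`: the set of points lying in a 3-dimensional subspace. -/
def IsPlane {F : Type*} [Field F] (π : Set (PGPoint F)) : Prop :=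
  ∃ W : Submodule F (Fin 4 → F), Module.finrank F W = 3 ∧ π = {P | P.rep ∈ W}

section Counting

variable {F : Type*} [Field F] [Fintype F]

theorem card_filter_pow_eq [DecidableEq F] {ξ : F} {a b : ℕ}
    (hξ : ∀ x : F, x ≠ 0 → ∃ m : ℕ, x = ξ ^ m) (hprim : IsPrimitiveRoot ξ (a * b))
    (ha : 0 < a) (hb : 0 < b) {c : F} (hc : c ^ a = 1) :
    (Finset.univ.filter fun x : F => x ^ b = c).card = b := by
  have hc0 : c ≠ 0 := by
    rintro rfl
    rw [zero_pow ha.ne'] at hc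
    exact zero_ne_one hc
  have hroot : IsPrimitiveRoot (ξ ^ a) b := hprim.pow (Nat.mul_pos ha hb) rfl
  have hex : ∃ y : F, y ^ b = c := by
    obtain ⟨m, rfl⟩ := hξ c hc0
    rw [← pow_mul, hprim.pow_eq_one_iff_dvd, mul_comm m a] at hc
    obtain ⟨k, rfl⟩ := Nat.dvd_of_mul_dvd_mul_left ha hc
    exact ⟨ξ ^ k, by rw [← pow_mul, mul_comm]⟩
  have hcard := hroot.card_nthRoots c
  rw [if_pos hex] at hcard
  have heq : (Finset.univ.filter fun x : F => x ^ b = c)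
      = (Polynomial.nthRoots b c).toFinset := by
    ext x
    simp [Polynomial.mem_nthRoots hb]
  rw [heq, Multiset.toFinset_card_of_nodup (hroot.nthRoots_nodup hc0), hcard]

theorem isPrimitiveRoot_of_forall_eq_pow {ξ : F} {q : ℕ} (hF : Fintype.card F = q ^ 2)
    (h0 : ξ ≠ 0) (hξ : ∀ x : F, x ≠ 0 → ∃ m : ℕ, x = ξ ^ m) :
    IsPrimitiveRoot ξ (q ^ 2 - 1) := by
  classical
  have horder : orderOf (Units.mk0 ξ h0) = q ^ 2 - 1 := by
    rw [orderOf_eq_card_of_forall_mem_zpowers, Nat.card_eq_fintype_card, Fintype.card_units, hF]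
    intro x
    obtain ⟨m, hm⟩ := hξ x x.ne_zero
    exact ⟨m, by ext; simp [hm]⟩
  have h := IsPrimitiveRoot.orderOf (Units.mk0 ξ h0)
  rw [horder] at h
  exact IsPrimitiveRoot.coe_units_iff.mpr h

theorem add_pow_of_card_eq {p n q : ℕ} (hp : p.Prime) (hq : q = p ^ n)
    (hF : Fintype.card F = q ^ 2) (a b : F) : (a + b) ^ q = a ^ q + b ^ q := by
  have : Fact p.Prime := ⟨hp⟩
  have : CharP F p := charP_of_card_eq_prime_pow (f := n * 2) (by
    rw [hF, hq, pow_mul])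
  rw [hq]
  exact add_pow_char_pow a b ..

/-- The affine equation `t + t^q - 2 t^((q+1)/2) = y^(q+1)`, with `q = 2 h + 1`. -/
theorem card_filter_affine [DecidableEq F] {ξ : F} {h : ℕ} (hh : 0 < h)
    (hξ : ∀ x : F, x ≠ 0 → ∃ m : ℕ, x = ξ ^ m)
    (hprim : IsPrimitiveRoot ξ (4 * h * (h + 1)))
    (hadd : ∀ a b : F, (a + b) ^ (2 * h + 1) = a ^ (2 * h + 1) + b ^ (2 * h + 1))
    (hfrob : ∀ a : F, (a ^ (2 * h + 1)) ^ (2 * h + 1) = a) (h2 : (2 : F) ≠ 0) :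
    (Finset.univ.filter fun x : F × F =>
      x.1 + x.1 ^ (2 * h + 1) - 2 * x.1 ^ (h + 1) = x.2 ^ (2 * h + 2)).card
      = (h + 1) * (4 * h ^ 2 + 2 * h + 1) := by
  have hneg : ∀ a : F, (-a) ^ (2 * h + 1) = -a ^ (2 * h + 1) := fun a =>
    Odd.neg_pow ⟨h, rfl⟩ a
  have h2q : (2 : F) ^ (2 * h + 1) = 2 := by
    have := hadd 1 1
    simpa [one_add_one_eq_two] using this
  have hfactor : ∀ t : F, t + t ^ (2 * h + 1) - 2 * t ^ (h + 1) = t * (t ^ h - 1) ^ 2 := by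
    intro t; ring
  have hZ : (Finset.univ.filter fun x : F => x ^ h = 1).card = h :=
    card_filter_pow_eq (a := 4 * (h + 1)) hξ (by convert hprim using 1; ring) (by positivity) hh
      (one_pow _)
  have hS : (Finset.univ.filter fun x : F => x ^ (2 * h * (h + 1)) = 1).card
      = 2 * h * (h + 1) :=
    card_filter_pow_eq (a := 2) hξ (by convert hprim using 1; ring) (by positivity)
      (by positivity) (one_pow _)
  have hfiber : ∀ t : F,
      (Finset.univ.filter fun y : F =>
        t + t ^ (2 * h + 1) - 2 * t ^ (h + 1) = y ^ (2 * h + 2)).card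
        + (2 * h + 2) * (if t ^ h = 1 then 1 else 0)
      = (if t = 0 then 1 else 0) + (if t ^ h = 1 then 1 else 0)
        + (2 * h + 2) * (if t ^ (2 * h * (h + 1)) = 1 then 1 else 0) := by
    intro t
    by_cases ht : t = 0 ∨ t ^ h = 1
    · have hzero : t * (t ^ h - 1) ^ 2 = 0 := by
        rcases ht with ht | ht <;> simp [ht]
      have hfilter : (Finset.univ.filter fun y : F =>
          t + t ^ (2 * h + 1) - 2 * t ^ (h + 1) = y ^ (2 * h + 2)) = {0} := by
        ext y
        rw [Finset.mem_filter, hfactor, hzero, eq_comm (a := (0 : F))]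
        simp
      rw [hfilter]
      rcases ht with rfl | ht
      · simp [hh.ne']
      · have ht0 : t ≠ 0 := by
          rintro rfl
          simp [hh.ne'] at ht
        have hts : t ^ (2 * h * (h + 1)) = 1 := by
          rw [show 2 * h * (h + 1) = h * (2 * (h + 1)) by ring, pow_mul, ht, one_pow]
        simp [ht, ht0, hts]
    · push Not at ht
      obtain ⟨ht0, hth⟩ := ht
      by_cases hts : t ^ (2 * h * (h + 1)) = 1
      · have hc0 : t + t ^ (2 * h + 1) - 2 * t ^ (h + 1) ≠ 0 := by
          rw [hfactor]
          exact mul_ne_zero ht0 (pow_ne_zero _ (sub_ne_zero.mpr hth))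
        have hm : (t ^ (h + 1)) ^ (2 * h + 1) = t ^ (h + 1) := by
          rw [← pow_mul, show (h + 1) * (2 * h + 1) = 2 * h * (h + 1) + (h + 1) by ring,
            pow_add, hts, one_mul]
        have hcq : (t + t ^ (2 * h + 1) - 2 * t ^ (h + 1)) ^ (2 * h + 1)
            = t + t ^ (2 * h + 1) - 2 * t ^ (h + 1) := by
          rw [sub_eq_add_neg, hadd, hadd, hneg, mul_pow, h2q, hm, hfrob]
          ring
        have hc : (t + t ^ (2 * h + 1) - 2 * t ^ (h + 1)) ^ (2 * h) = 1 := by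
          rw [pow_succ] at hcq
          exact mul_right_cancel₀ hc0 (hcq.trans (one_mul _).symm)
        have hcard := card_filter_pow_eq (b := 2 * h + 2) hξ
          (by convert hprim using 1; ring) (by positivity) (by positivity) hc
        simp only [eq_comm (a := t + t ^ (2 * h + 1) - 2 * t ^ (h + 1))]
        rw [hcard]
        simp [ht0, hth, hts]
      · have hfilter : (Finset.univ.filter fun y : F =>
            t + t ^ (2 * h + 1) - 2 * t ^ (h + 1) = y ^ (2 * h + 2)) = ∅ := by
          rw [Finset.filter_eq_empty_iff]
          intro y _ hy
          apply hts
          have hyq : (y ^ (2 * h + 2)) ^ (2 * h + 1) = y ^ (2 * h + 2) := by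
            rw [show y ^ (2 * h + 2) = y ^ (2 * h + 1) * y by ring, mul_pow, hfrob, mul_comm]
          rw [← hy, sub_eq_add_neg, hadd, hadd, hneg, mul_pow, h2q, hfrob] at hyq
          have hm : (t ^ (h + 1)) ^ (2 * h + 1) = t ^ (h + 1) := by
            apply mul_left_cancel₀ h2
            linear_combination -hyq
          have hm0 : t ^ (h + 1) ≠ 0 := pow_ne_zero _ ht0
          rw [pow_succ, ← pow_mul] at hm
          have := mul_right_cancel₀ hm0 (hm.trans (one_mul _).symm)
          rwa [show 2 * h * (h + 1) = (h + 1) * (2 * h) by ring]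
        rw [hfilter]
        simp [ht0, hth, hts]
  have hsum := Finset.sum_congr (s₁ := (Finset.univ : Finset F)) rfl fun t _ => hfiber t
  simp only [Finset.sum_add_distrib, ← Finset.mul_sum, ← Finset.card_filter, hZ, hS] at hsum
  have hB : (Finset.univ.filter fun x : F × F =>
      x.1 + x.1 ^ (2 * h + 1) - 2 * x.1 ^ (h + 1) = x.2 ^ (2 * h + 2)).card
      = ∑ t : F, (Finset.univ.filter fun y : F =>
        t + t ^ (2 * h + 1) - 2 * t ^ (h + 1) = y ^ (2 * h + 2)).card := by
    simp only [Finset.card_filter]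
    exact Fintype.sum_prod_type _
  rw [hB]
  have hone : (Finset.univ.filter fun x : F => x = 0).card = 1 := by
    simp [Finset.filter_eq']
  rw [hone] at hsum
  nlinarith [hsum]

end Counting

section Points

variable {F : Type*} [Field F]

theorem Fgam_smul {q : ℕ} (hq : Odd q) (γ l : F) (v : Fin 4 → F) :
    Fgam q γ (l • v) = l ^ (q + 1) * Fgam q γ v := by
  obtain ⟨h, rfl⟩ := hq
  have hdiv : (2 * h + 1 + 1) / 2 = h + 1 := by omega
  have hdet : (l * v 0 * (l * v 3) - l * v 1 * (l * v 2)) ^ (h + 1)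
      = l ^ (2 * h + 1 + 1) * (v 0 * v 3 - v 1 * v 2) ^ (h + 1) := by
    rw [show l * v 0 * (l * v 3) - l * v 1 * (l * v 2) = l ^ 2 * (v 0 * v 3 - v 1 * v 2) by ring,
      mul_pow, ← pow_mul]
    ring
  simp only [Fgam, Pi.smul_apply, smul_eq_mul, hdiv, hdet]
  ring

theorem mk_mem_Cgam_iff {q : ℕ} (hq : Odd q) {γ : F} {v : Fin 4 → F} (hv : v ≠ 0) :
    Projectivization.mk F v hv ∈ Cgam q γ ↔ Fgam q γ v = 0 := by
  refine ⟨fun h => h v hv rfl, fun h w hw hvw => ?_⟩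
  obtain ⟨l, rfl⟩ := (Projectivization.mk_eq_mk_iff' F v w hv hw).mp hvw
  rw [Fgam_smul hq] at h
  have hl : l ≠ 0 := by
    rintro rfl
    exact hv (zero_smul _ _)
  exact (mul_eq_zero.mp h).resolve_left (pow_ne_zero _ hl)

theorem ncard_Cgam_le_neg [Fintype F] {q : ℕ} (hq : Odd q)
    (hfrob : ∀ a : F, (a ^ q) ^ q = a) {ξ : F} (h0 : ξ ≠ 0)
    (hneg : ξ ^ ((q - 1) * (q + 1) / 2) = -1) (γ : F) :
    (Cgam q γ).ncard ≤ (Cgam q (-γ)).ncard := by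
  set d : Fin 4 → F := ![ξ ^ q, ξ ^ q / ξ, 1, ξ⁻¹] with hd
  have hd0 : ∀ i, d i ≠ 0 := by
    intro i
    fin_cases i <;> simp [hd, h0]
  have hinj : Function.Injective (LinearMap.mulLeft F d) := by
    intro v w hvw
    ext i
    exact mul_left_cancel₀ (hd0 i) (congrFun hvw i)
  have hF : ∀ v, Fgam q (-γ) (d * v) = Fgam q γ v := by
    intro v
    obtain ⟨h, rfl⟩ := hq
    have hdiv : (2 * h + 1 + 1) / 2 = h + 1 := by omega
    have hdiv' : (2 * h + 1 - 1) * (2 * h + 1 + 1) / 2 = 2 * h * (h + 1) := by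
      rw [show (2 * h + 1 - 1) * (2 * h + 1 + 1) = 2 * (2 * h * (h + 1)) by
        rw [Nat.add_sub_cancel]; ring]
      exact Nat.mul_div_cancel_left _ two_pos
    rw [hdiv'] at hneg
    have hdet : (ξ ^ (2 * h + 1) * v 0 * (ξ⁻¹ * v 3)
        - ξ ^ (2 * h + 1) / ξ * v 1 * v 2) ^ (h + 1) = -(v 0 * v 3 - v 1 * v 2) ^ (h + 1) := by
      rw [show ξ ^ (2 * h + 1) * v 0 * (ξ⁻¹ * v 3) - ξ ^ (2 * h + 1) / ξ * v 1 * v 2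
        = ξ ^ (2 * h) * (v 0 * v 3 - v 1 * v 2) by field_simp; ring, mul_pow, ← pow_mul, hneg]
      ring
    have h1 : (ξ ^ (2 * h + 1) / ξ) ^ (2 * h + 1 + 1) = 1 := by
      rw [pow_succ, div_pow, hfrob]
      field_simp
    simp [Fgam, hd, hdiv, hdet, mul_pow, h1, hfrob]
    field_simp
  refine Set.ncard_le_ncard_of_injOn (Projectivization.map (LinearMap.mulLeft F d) hinj) ?_
    (Projectivization.map_injective _ hinj).injOn (Set.toFinite _)
  intro P
  induction P using Projectivization.ind with
  | h v hv =>
    intro hP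
    rw [Projectivization.map_mk]
    exact (mk_mem_Cgam_iff hq _).mpr ((hF v).trans ((mk_mem_Cgam_iff hq hv).mp hP))

/-- The points off the plane `X₁ = 0`, in the coordinates `(a, t, y)` with `a = X₂ / X₁`,
`t = (X₁X₄ - X₂X₃) / X₁²` and `y = X₃ / X₁ - a^q`. -/
def affinePoint (q : ℕ) (x : F × F × F) : PGPoint F :=
  Projectivization.mk F ![1, x.1, x.1 ^ q + x.2.2, x.1 * (x.1 ^ q + x.2.2) + x.2.1]
    fun h => one_ne_zero (congrFun h 0)

/-- The points of the plane `X₁ = 0` off the line `X₁ = X₂ = 0`. -/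
def infinitePoint (x : F × F) : PGPoint F :=
  Projectivization.mk F ![0, 1, x.1, x.2] fun h => one_ne_zero (congrFun h 1)

/-- The point `(0,0,0,1)`. -/
def lastPoint (F : Type*) [Field F] : PGPoint F :=
  Projectivization.mk F ![0, 0, 0, 1] fun h => one_ne_zero (congrFun h 3)

theorem affinePoint_injective (q : ℕ) : Function.Injective (affinePoint (F := F) q) := by
  rintro ⟨a, t, y⟩ ⟨a', t', y'⟩ h
  obtain ⟨l, hl⟩ := (Projectivization.mk_eq_mk_iff' F _ _ _ _).mp h
  have e0 : l = 1 := by simpa using congrFun hl 0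
  subst e0
  have e1 : a' = a := by simpa using congrFun hl 1
  subst e1
  have e2 : y' = y := by simpa using congrFun hl 2
  subst e2
  have e3 : t' = t := by simpa using congrFun hl 3
  rw [e3]

theorem infinitePoint_injective : Function.Injective (infinitePoint (F := F)) := by
  rintro ⟨a, b⟩ ⟨a', b'⟩ h
  obtain ⟨l, hl⟩ := (Projectivization.mk_eq_mk_iff' F _ _ _ _).mp h
  have e0 : l = 1 := by simpa using congrFun hl 1
  subst e0
  have e1 : a' = a := by simpa using congrFun hl 2
  have e2 : b' = b := by simpa using congrFun hl 3
  rw [e1, e2]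

theorem affinePoint_ne_infinitePoint (q : ℕ) (x : F × F × F) (y : F × F) :
    affinePoint q x ≠ infinitePoint y := by
  intro h
  obtain ⟨l, hl⟩ := (Projectivization.mk_eq_mk_iff' F _ _ _ _).mp h
  simpa using congrFun hl 0

theorem affinePoint_ne_lastPoint (q : ℕ) (x : F × F × F) :
    affinePoint q x ≠ lastPoint F := by
  intro h
  obtain ⟨l, hl⟩ := (Projectivization.mk_eq_mk_iff' F _ _ _ _).mp h
  simpa using congrFun hl 0

theorem infinitePoint_ne_lastPoint (x : F × F) : infinitePoint x ≠ lastPoint F := by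
  intro h
  obtain ⟨l, hl⟩ := (Projectivization.mk_eq_mk_iff' F _ _ _ _).mp h
  simpa using congrFun hl 1

theorem affinePoint_mem_Cgam_iff {h : ℕ}
    (hadd : ∀ a b : F, (a + b) ^ (2 * h + 1) = a ^ (2 * h + 1) + b ^ (2 * h + 1))
    (hfrob : ∀ a : F, (a ^ (2 * h + 1)) ^ (2 * h + 1) = a) (a t y : F) :
    affinePoint (2 * h + 1) (a, t, y) ∈ Cgam (2 * h + 1) (2 : F) ↔
      t + t ^ (2 * h + 1) - 2 * t ^ (h + 1) = y ^ (2 * h + 2) := by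
  have hdiv : (2 * h + 1 + 1) / 2 = h + 1 := by omega
  rw [affinePoint, mk_mem_Cgam_iff ⟨h, rfl⟩, ← sub_eq_zero (b := y ^ (2 * h + 2))]
  refine Eq.congr_left ?_
  simp only [Fgam, hdiv, Matrix.cons_val]
  rw [show (1 : F) * (a * (a ^ (2 * h + 1) + y) + t) - a * (a ^ (2 * h + 1) + y) = t by ring,
    pow_succ (a ^ (2 * h + 1) + y), hadd (a * _), mul_pow, hadd (a ^ _), hfrob]
  ring

theorem infinitePoint_mem_Cgam_iff {h : ℕ} (x z : F) :
    infinitePoint (x, z) ∈ Cgam (2 * h + 1) (2 : F) ↔ (-x) ^ (h + 1) = -1 := by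
  have hdiv : (2 * h + 1 + 1) / 2 = h + 1 := by omega
  rw [infinitePoint, mk_mem_Cgam_iff ⟨h, rfl⟩]
  have heq : Fgam (2 * h + 1) (2 : F) ![0, 1, x, z] = -((-x) ^ (h + 1) + 1) ^ 2 := by
    have hx : x ^ (2 * h + 1 + 1) = ((-x) ^ (h + 1)) ^ 2 := by
      rw [← pow_mul, mul_comm (h + 1) 2, pow_mul (-x), neg_sq, ← pow_mul]
      ring
    simp [Fgam, hdiv, hx]
    ring
  rw [heq, neg_eq_zero, sq_eq_zero_iff, add_eq_zero_iff_eq_neg]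

theorem lastPoint_mem_Cgam {q : ℕ} (hq : Odd q) (γ : F) : lastPoint F ∈ Cgam q γ := by
  obtain ⟨h, rfl⟩ := hq
  have hdiv : (2 * h + 1 + 1) / 2 = h + 1 := by omega
  rw [lastPoint, mk_mem_Cgam_iff ⟨h, rfl⟩]
  simp [Fgam, hdiv]

theorem Cgam_two_eq {h : ℕ}
    (hadd : ∀ a b : F, (a + b) ^ (2 * h + 1) = a ^ (2 * h + 1) + b ^ (2 * h + 1))
    (hfrob : ∀ a : F, (a ^ (2 * h + 1)) ^ (2 * h + 1) = a) :
    Cgam (2 * h + 1) (2 : F) =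
      affinePoint (2 * h + 1) '' (Set.univ ×ˢ
        {x : F × F | x.1 + x.1 ^ (2 * h + 1) - 2 * x.1 ^ (h + 1) = x.2 ^ (2 * h + 2)})
      ∪ infinitePoint '' ({x : F | (-x) ^ (h + 1) = -1} ×ˢ Set.univ) ∪ {lastPoint F} := by
  have hodd : Odd (2 * h + 1) := ⟨h, rfl⟩
  apply Set.Subset.antisymm
  · intro P
    induction P using Projectivization.ind with
    | h v hv =>
      intro hP
      by_cases h0 : v 0 = 0
      · by_cases h1 : v 1 = 0
        · right
          have hF := (mk_mem_Cgam_iff hodd hv).mp hP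
          have hdiv : (2 * h + 1 + 1) / 2 = h + 1 := by omega
          have h2 : v 2 = 0 := by simpa [Fgam, h0, h1, hdiv] using hF
          refine (Projectivization.mk_eq_mk_iff' F _ _ _ _).mpr ⟨v 3, ?_⟩
          ext i
          fin_cases i <;> simp [h0, h1, h2]
        · left; right
          have hmk : Projectivization.mk F v hv = infinitePoint (v 2 / v 1, v 3 / v 1) := by
            refine (Projectivization.mk_eq_mk_iff' F _ _ _ _).mpr ⟨v 1, ?_⟩
            ext i
            fin_cases i <;> simp [h0] <;> field_simp
          rw [hmk] at hP ⊢
          exact Set.mem_image_of_mem _ ⟨(infinitePoint_mem_Cgam_iff _ _).mp hP, Set.mem_univ _⟩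
      · left; left
        set a := v 1 / v 0 with ha
        set y := v 2 / v 0 - a ^ (2 * h + 1) with hy
        set t := v 3 / v 0 - a * (v 2 / v 0) with ht
        have hmk : Projectivization.mk F v hv = affinePoint (2 * h + 1) (a, t, y) := by
          refine (Projectivization.mk_eq_mk_iff' F _ _ _ _).mpr ⟨v 0, ?_⟩
          ext i
          fin_cases i <;> simp [hy, ht, ha] <;> field_simp
        rw [hmk] at hP ⊢
        exact Set.mem_image_of_mem _
          ⟨Set.mem_univ _, (affinePoint_mem_Cgam_iff hadd hfrob a t y).mp hP⟩
  · rintro P ((⟨⟨a, t, y⟩, hx, rfl⟩ | ⟨⟨x, z⟩, hx, rfl⟩) | hP)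
    · exact (affinePoint_mem_Cgam_iff hadd hfrob a t y).mpr (Set.mem_prod.mp hx).2
    · exact (infinitePoint_mem_Cgam_iff x z).mpr (Set.mem_prod.mp hx).1
    · rw [Set.mem_singleton_iff.mp hP]
      exact lastPoint_mem_Cgam hodd _

theorem ncard_Cgam_two [Fintype F] {ξ : F} {h : ℕ} (hh : 0 < h)
    (hF : Fintype.card F = (2 * h + 1) ^ 2)
    (hξ : ∀ x : F, x ≠ 0 → ∃ m : ℕ, x = ξ ^ m)
    (hprim : IsPrimitiveRoot ξ (4 * h * (h + 1)))
    (hadd : ∀ a b : F, (a + b) ^ (2 * h + 1) = a ^ (2 * h + 1) + b ^ (2 * h + 1))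
    (hfrob : ∀ a : F, (a ^ (2 * h + 1)) ^ (2 * h + 1) = a) (h2 : (2 : F) ≠ 0) :
    (Cgam (2 * h + 1) (2 : F)).ncard
      = (2 * h + 1) ^ 2 * ((h + 1) * (4 * h ^ 2 + 2 * h + 1))
        + (h + 1) * (2 * h + 1) ^ 2 + 1 := by
  classical
  have hcardF : (Set.univ : Set F).ncard = (2 * h + 1) ^ 2 := by
    rw [Set.ncard_univ, Nat.card_eq_fintype_card, hF]
  have hB : {x : F × F | x.1 + x.1 ^ (2 * h + 1) - 2 * x.1 ^ (h + 1)
      = x.2 ^ (2 * h + 2)}.ncard = (h + 1) * (4 * h ^ 2 + 2 * h + 1) := by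
    rw [← card_filter_affine hh hξ hprim hadd hfrob h2, ← Set.ncard_coe_finset]
    simp
  have hD : {x : F | (-x) ^ (h + 1) = -1}.ncard = h + 1 := by
    have hcard := card_filter_pow_eq (a := 4 * h) (b := h + 1) (c := -1) hξ hprim
      (by positivity) (by positivity) (Even.neg_one_pow ⟨2 * h, by ring⟩)
    rw [← Set.ncard_coe_finset, ← Set.ncard_image_of_injective _ neg_injective] at hcard
    refine (congrArg Set.ncard ?_).trans hcard
    ext x
    simp
  rw [Cgam_two_eq hadd hfrob, Set.ncard_union_eq, Set.ncard_union_eq,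
    Set.ncard_image_of_injective _ (affinePoint_injective _),
    Set.ncard_image_of_injective _ infinitePoint_injective,
    Set.ncard_prod, Set.ncard_prod, hcardF, hB, hD, Set.ncard_singleton]
  · rw [Set.disjoint_left]
    rintro _ ⟨x, -, rfl⟩ ⟨y, -, hy⟩
    exact affinePoint_ne_infinitePoint _ _ _ hy.symm
  · rw [Set.disjoint_singleton_right]
    rintro (⟨x, -, hx⟩ | ⟨x, -, hx⟩)
    · exact affinePoint_ne_lastPoint _ _ hx
    · exact infinitePoint_ne_lastPoint _ hx

end Points

/-- Lemma 2.6 iv): `|E₀| = |E_{q−1}| = q³(q²+1)/2 + q² + 1`. -/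
theorem stmt6 {F : Type*} [Field F] [Fintype F] (p n q : ℕ) (hp : p.Prime)
    (hodd : Odd p) (hn : 0 < n) (hq : q = p ^ n) (hF : Fintype.card F = q ^ 2)
    (ξ : F) (hξ : ∀ x : F, x ≠ 0 → ∃ m : ℕ, x = ξ ^ m) :
    (Cgam q (ξ ^ (0 * (q + 1) / 2) + (ξ ^ (0 * (q + 1) / 2))⁻¹)).ncard
        = q ^ 3 * (q ^ 2 + 1) / 2 + q ^ 2 + 1 ∧
    (Cgam q (ξ ^ ((q - 1) * (q + 1) / 2) + (ξ ^ ((q - 1) * (q + 1) / 2))⁻¹)).ncard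
        = q ^ 3 * (q ^ 2 + 1) / 2 + q ^ 2 + 1 := by
  have hqodd : Odd q := hq ▸ hodd.pow
  have hq1 : 1 < q := hq ▸ Nat.one_lt_pow hn.ne' hp.one_lt
  have h2 : (2 : F) ≠ 0 := by
    refine Ring.two_ne_zero ?_
    rw [Ne, FiniteField.even_card_iff_char_two, hF, ← Nat.even_iff, Nat.not_even_iff_odd]
    exact hqodd.pow
  have h0 : ξ ≠ 0 := by
    rintro rfl
    obtain ⟨m, hm⟩ := hξ (-1) (neg_ne_zero.mpr one_ne_zero)
    rcases Nat.eq_zero_or_pos m with rfl | hm0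
    · exact h2 (by linear_combination -hm)
    · simp [hm0.ne'] at hm
  have hprim := isPrimitiveRoot_of_forall_eq_pow hF h0 hξ
  have hadd := add_pow_of_card_eq (F := F) hp hq hF
  have hfrob : ∀ a : F, (a ^ q) ^ q = a := fun a => by
    rw [← pow_mul, ← sq, ← hF, FiniteField.pow_card]
  clear hq
  obtain ⟨h, rfl⟩ := hqodd
  have hh : 0 < h := by omega
  rw [show (2 * h + 1) ^ 2 - 1 = 4 * h * (h + 1) by
    rw [Nat.sub_eq_iff_eq_add (Nat.one_le_pow _ _ (by positivity))]; ring] at hprim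
  have hdiv : (2 * h + 1 - 1) * (2 * h + 1 + 1) / 2 = 2 * h * (h + 1) := by
    rw [show (2 * h + 1 - 1) * (2 * h + 1 + 1) = 2 * (2 * h * (h + 1)) by
      rw [Nat.add_sub_cancel]; ring]
    exact Nat.mul_div_cancel_left _ two_pos
  have hneg : ξ ^ ((2 * h + 1 - 1) * (2 * h + 1 + 1) / 2) = -1 := by
    rw [hdiv]
    exact IsPrimitiveRoot.eq_neg_one_of_two_right
      (hprim.pow (b := 2) (a := 2 * h * (h + 1)) (by positivity) (by ring))
  have htwo : (Cgam (2 * h + 1) (2 : F)).ncard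
      = (2 * h + 1) ^ 3 * ((2 * h + 1) ^ 2 + 1) / 2 + (2 * h + 1) ^ 2 + 1 := by
    rw [ncard_Cgam_two hh hF hξ hprim hadd hfrob h2,
      show (2 * h + 1) ^ 3 * ((2 * h + 1) ^ 2 + 1)
        = 2 * ((2 * h + 1) ^ 3 * (2 * h ^ 2 + 2 * h + 1)) by ring,
      Nat.mul_div_cancel_left _ two_pos]
    ring
  have hle := ncard_Cgam_le_neg (⟨h, rfl⟩ : Odd (2 * h + 1)) hfrob h0 hneg
  have hswap : (Cgam (2 * h + 1) (-2 : F)).ncard = (Cgam (2 * h + 1) (2 : F)).ncard :=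
    le_antisymm (by simpa using hle (-2)) (hle 2)
  rw [hneg]
  refine ⟨?_, ?_⟩
  · simpa [one_add_one_eq_two] using htwo
  · rw [show (-1 : F) + (-1)⁻¹ = -2 by norm_num, hswap, htwo]
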